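/- Let n ≥ 8 and let 𝒻 be a family of 3-element subsets of [n] that shatters no 3-element subset, with |𝒻| ≥ C(n−1, 2) + 2. Assume that every family of 3-element subsets of an (n−1)-element set that shatters no 3-element subset has size at most C(n−2, 2) + 1. Let W be a maximal witness assignment for 𝒻 and suppose W(F) ≠ ∅ for every F ∈ 𝒻. Then |L| ≤ n − 2, where L := {x ∈ [n] : there exists F ∈ 𝒻 with W(F) = {x}}. -/

import Mathlib

/-- A family `𝒻` shatters a set `S` if every subset of `S` is the trace of some member of `𝒻`. -/
def Shatters (𝒻 : Finset (Finset ℕ)) (S : Finset ℕ) : Prop :=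
  ∀ T ⊆ S, ∃ F ∈ 𝒻, F ∩ S = T

/-- `W` is a maximal witness assignment for `𝒻`. -/
def MaximalWitness (𝒻 : Finset (Finset ℕ)) (W : Finset ℕ → Finset ℕ) : Prop :=
  ∀ F ∈ 𝒻, W F ⊂ F ∧ (∀ G ∈ 𝒻, G ∩ F ≠ W F) ∧
    ∀ B : Finset ℕ, B ⊂ F → (W F).card < B.card → ∃ G ∈ 𝒻, G ∩ F = B

open Finset hiding Shatters

/-- A member of a 3-uniform family containing a two-element witness of `F` equals `F`. -/
lemma MaximalWitness.eq_of_subset {𝒻 : Finset (Finset ℕ)} {W : Finset ℕ → Finset ℕ}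
    (hW : MaximalWitness 𝒻 W) (hcard : ∀ F ∈ 𝒻, F.card = 3) {F G : Finset ℕ}
    (hF : F ∈ 𝒻) (hG : G ∈ 𝒻) (h2 : (W F).card = 2) (h : W F ⊆ G) : G = F := by
  obtain ⟨hs, hne, -⟩ := hW F hF
  have hsub : W F ⊂ G ∩ F :=
    (subset_inter h hs.subset).ssubset_of_ne (hne G hG).symm
  have hlt := card_lt_card hsub
  have h1 : G ∩ F = F := eq_of_subset_of_card_le inter_subset_right (by rw [hcard F hF]; omega)
  have h3 : G ∩ F = G := eq_of_subset_of_card_le inter_subset_left (by rw [hcard G hG]; omega)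
  exact h3.symm.trans h1

/-- If families on one point fewer are small, every point lies in at least `n - 1` members. -/
lemma le_degree {n : ℕ} (hn : 8 ≤ n) {𝒻 : Finset (Finset ℕ)} {V : Finset ℕ} (hV : V.card = n)
    (hsub : ∀ F ∈ 𝒻, F ⊆ V) (hcard : ∀ F ∈ 𝒻, F.card = 3)
    (hVC : ∀ S ⊆ V, S.card = 3 → ¬ Shatters 𝒻 S)
    (hbig : (n - 1).choose 2 + 2 ≤ 𝒻.card)
    (ih : ∀ (V : Finset ℕ) (𝒢 : Finset (Finset ℕ)), V.card = n - 1 →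
      (∀ G ∈ 𝒢, G ⊆ V) → (∀ G ∈ 𝒢, G.card = 3) →
      (∀ S ⊆ V, S.card = 3 → ¬ Shatters 𝒢 S) →
      𝒢.card ≤ (n - 2).choose 2 + 1) {x : ℕ} (hx : x ∈ V) :
    n - 1 ≤ (𝒻.filter (x ∈ ·)).card := by
  have h := ih (V.erase x) (𝒻.filter (x ∉ ·)) (by rw [card_erase_of_mem hx, hV])
    (by
      intro G hG
      rw [mem_filter] at hG
      exact subset_erase.2 ⟨hsub G hG.1, hG.2⟩)
    (fun G hG => hcard G (mem_filter.1 hG).1)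
    (by
      intro S hS h3 hsh
      refine hVC S (hS.trans (erase_subset _ _)) h3 fun T hT => ?_
      obtain ⟨F, hF, hFT⟩ := hsh T hT
      exact ⟨F, (mem_filter.1 hF).1, hFT⟩)
  have hsplit := card_filter_add_card_filter_not (s := 𝒻) (x ∈ ·)
  obtain ⟨m, rfl⟩ : ∃ m, n = m + 2 := ⟨n - 2, by omega⟩
  have hp : (m + 1).choose 2 = m + m.choose 2 := by
    rw [Nat.choose_succ_succ' m 1, Nat.choose_one_right]
  simp only [Nat.add_sub_cancel, show m + 2 - 1 = m + 1 by omega] at *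
  omega

lemma card_pairs_erase_le {n : ℕ} {V : Finset ℕ} (hV : V.card = n) {v : ℕ} (hv : v ∈ V)
    {P : Finset (Finset ℕ)} (hP : ∀ p ∈ P, p ⊆ V.erase v ∧ p.card = 2) :
    P.card ≤ (n - 1).choose 2 := by
  have : P ⊆ powersetCard 2 (V.erase v) := fun p hp => mem_powersetCard.2 (hP p hp)
  simpa [card_powersetCard, card_erase_of_mem hv, hV] using card_le_card this

lemma injOn_erase (𝒻 : Finset (Finset ℕ)) (v : ℕ) :
    Set.InjOn (fun F : Finset ℕ => F.erase v) (𝒻.filter (v ∈ ·) : Finset (Finset ℕ)) := by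
  intro F hF G hG h
  simp only [coe_filter, Set.mem_ofPred_eq] at hF hG
  rw [← insert_erase hF.2, ← insert_erase hG.2]
  exact congrArg (insert v) h

/-- Members through `v` and members avoiding `v` with a two-element witness correspond to
distinct pairs in `V \ {v}`. -/
lemma MaximalWitness.degree_add_le {n : ℕ} {𝒻 : Finset (Finset ℕ)} {W : Finset ℕ → Finset ℕ}
    (hW : MaximalWitness 𝒻 W) {V : Finset ℕ} (hV : V.card = n)
    (hsub : ∀ F ∈ 𝒻, F ⊆ V) (hcard : ∀ F ∈ 𝒻, F.card = 3) {v : ℕ} (hv : v ∈ V) :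
    (𝒻.filter (v ∈ ·)).card + (𝒻.filter fun E => v ∉ E ∧ (W E).card = 2).card
      ≤ (n - 1).choose 2 := by
  set A := 𝒻.filter (v ∈ ·)
  set B := 𝒻.filter fun E => v ∉ E ∧ (W E).card = 2
  have hA : (A.image fun F => F.erase v).card = A.card := card_image_of_injOn (injOn_erase 𝒻 v)
  have hB : (B.image W).card = B.card := by
    refine card_image_of_injOn fun E hE E' hE' h => ?_
    simp only [B, coe_filter, Set.mem_ofPred_eq] at hE hE'
    exact hW.eq_of_subset hcard hE'.1 hE.1 hE'.2.2 (h ▸ (hW E hE.1).1.subset)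
  have hdisj : Disjoint (A.image fun F => F.erase v) (B.image W) := by
    rw [disjoint_left]
    intro p hp hp'
    obtain ⟨F, hF, rfl⟩ := mem_image.1 hp
    obtain ⟨E, hE, hEF⟩ := mem_image.1 hp'
    simp only [A, B, mem_filter] at hF hE
    have := hW.eq_of_subset hcard hE.1 hF.1 hE.2.2 (hEF ▸ erase_subset _ _)
    exact hE.2.1 (this ▸ hF.2)
  rw [← hA, ← hB, ← card_union_of_disjoint hdisj]
  refine card_pairs_erase_le hV hv fun p hp => ?_
  rcases mem_union.1 hp with hp | hp
  · obtain ⟨F, hF, rfl⟩ := mem_image.1 hp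
    simp only [A, mem_filter] at hF
    exact ⟨erase_subset_erase _ (hsub F hF.1), by rw [card_erase_of_mem hF.2, hcard F hF.1]⟩
  · obtain ⟨E, hE, rfl⟩ := mem_image.1 hp
    simp only [B, mem_filter] at hE
    exact ⟨subset_erase.2 ⟨(hW E hE.1).1.subset.trans (hsub E hE.1),
      fun h => hE.2.1 ((hW E hE.1).1.subset h)⟩, hE.2.2⟩

lemma MaximalWitness.card_eq_one_or_two {𝒻 : Finset (Finset ℕ)} {W : Finset ℕ → Finset ℕ}
    (hW : MaximalWitness 𝒻 W) (hcard : ∀ F ∈ 𝒻, F.card = 3) (hne : ∀ F ∈ 𝒻, W F ≠ ∅)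
    {F : Finset ℕ} (hF : F ∈ 𝒻) : (W F).card = 1 ∨ (W F).card = 2 := by
  have h1 := card_lt_card (hW F hF).1
  have h2 := card_pos.2 (nonempty_iff_ne_empty.2 (hne F hF))
  have h3 := hcard F hF
  omega

/-- Every point is avoided by two distinct members with singleton witness. -/
lemma MaximalWitness.exists_pair_avoiding {n : ℕ} {𝒻 : Finset (Finset ℕ)}
    {W : Finset ℕ → Finset ℕ} (hW : MaximalWitness 𝒻 W) {V : Finset ℕ} (hV : V.card = n)
    (hsub : ∀ F ∈ 𝒻, F ⊆ V) (hcard : ∀ F ∈ 𝒻, F.card = 3)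
    (hbig : (n - 1).choose 2 + 2 ≤ 𝒻.card) (hne : ∀ F ∈ 𝒻, W F ≠ ∅) {v : ℕ} (hv : v ∈ V) :
    ∃ E₁ ∈ 𝒻, ∃ E₂ ∈ 𝒻, E₁ ≠ E₂ ∧ v ∉ E₁ ∧ v ∉ E₂ ∧
      (∃ w, W E₁ = {w}) ∧ ∃ w, W E₂ = {w} := by
  have hle := hW.degree_add_le hV hsub hcard hv
  have hsplit := card_filter_add_card_filter_not (s := 𝒻) (v ∈ ·)
  have hsplit' : (𝒻.filter (v ∉ ·)).card ≤ (𝒻.filter fun E => v ∉ E ∧ (W E).card = 1).card +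
      (𝒻.filter fun E => v ∉ E ∧ (W E).card = 2).card := by
    refine (card_le_card fun E hE => ?_).trans (card_union_le _ _)
    simp only [mem_union, mem_filter] at hE ⊢
    have := hW.card_eq_one_or_two hcard hne hE.1
    tauto
  obtain ⟨E₁, h₁, E₂, h₂, h⟩ := one_lt_card.1
    (show 1 < (𝒻.filter fun E => v ∉ E ∧ (W E).card = 1).card by omega)
  simp only [mem_filter, card_eq_one] at h₁ h₂
  exact ⟨E₁, h₁.1, E₂, h₂.1, h, h₁.2.1, h₂.2.1, h₁.2.2, h₂.2.2⟩

/-- A member with witness `{x}` has the form `{x, a, b}`. -/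
lemma MaximalWitness.exists_eq_triple {𝒻 : Finset (Finset ℕ)} {W : Finset ℕ → Finset ℕ}
    (hW : MaximalWitness 𝒻 W) (hcard : ∀ F ∈ 𝒻, F.card = 3) {F : Finset ℕ} (hF : F ∈ 𝒻) {x : ℕ}
    (hx : W F = {x}) : ∃ a b, x ≠ a ∧ x ≠ b ∧ a ≠ b ∧ F = {x, a, b} := by
  have hxF : x ∈ F := (hW F hF).1.subset (by simp [hx])
  have h2 : (F.erase x).card = 2 := by rw [card_erase_of_mem hxF, hcard F hF]
  obtain ⟨a, b, hab, h⟩ := card_eq_two.1 h2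
  have ha : a ∈ F.erase x := by simp [h]
  have hb : b ∈ F.erase x := by simp [h]
  exact ⟨a, b, (ne_of_mem_erase ha).symm, (ne_of_mem_erase hb).symm, hab,
    by rw [← insert_erase hxF, h]⟩

/-- If `F` has witness `{x}`, each member through `x` meets `F` in a second point. -/
lemma MaximalWitness.exists_mem_inter {𝒻 : Finset (Finset ℕ)} {W : Finset ℕ → Finset ℕ}
    (hW : MaximalWitness 𝒻 W) {F G : Finset ℕ} (hF : F ∈ 𝒻) (hG : G ∈ 𝒻) {x : ℕ}
    (hx : W F = {x}) (hxG : x ∈ G) : ∃ y ∈ G, y ∈ F ∧ y ≠ x := by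
  by_contra! h
  have hxF : x ∈ F := (hW F hF).1.subset (by simp [hx])
  refine (hW F hF).2.1 G hG ?_
  rw [hx]
  ext y
  simp only [mem_inter, mem_singleton]
  exact ⟨fun hy => h y hy.1 hy.2, by rintro rfl; exact ⟨hxG, hxF⟩⟩

lemma eq_triple_of_mem {F : Finset ℕ} (h3 : F.card = 3) {x y z : ℕ} (hx : x ∈ F) (hy : y ∈ F)
    (hz : z ∈ F) (hxy : x ≠ y) (hxz : x ≠ z) (hyz : y ≠ z) : F = {x, y, z} := by
  refine (eq_of_subset_of_card_le ?_ ?_).symm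
  · simp [insert_subset_iff, hx, hy, hz]
  · rw [h3, card_eq_three.2 ⟨x, y, z, hxy, hxz, hyz, rfl⟩]

lemma exists_eq_triple_of_mem {F : Finset ℕ} (h3 : F.card = 3) {x y : ℕ} (hx : x ∈ F)
    (hy : y ∈ F) (hxy : x ≠ y) : ∃ z, z ≠ x ∧ z ≠ y ∧ F = {x, y, z} := by
  have hlt : ({x, y} : Finset ℕ).card < F.card := by rw [card_pair hxy, h3]; omega
  obtain ⟨z, hz, hz'⟩ := exists_mem_notMem_of_card_lt_card hlt
  simp only [mem_insert, mem_singleton, not_or] at hz'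
  exact ⟨z, hz'.1, hz'.2, eq_triple_of_mem h3 hx hy hz hxy (Ne.symm hz'.1) (Ne.symm hz'.2)⟩

/-- Distinct members have distinct singleton witnesses. -/
lemma MaximalWitness.singleton_injective {n : ℕ} (hn : 8 ≤ n) {𝒻 : Finset (Finset ℕ)}
    {W : Finset ℕ → Finset ℕ} (hW : MaximalWitness 𝒻 W) {V : Finset ℕ} (hV : V.card = n)
    (hsub : ∀ F ∈ 𝒻, F ⊆ V) (hcard : ∀ F ∈ 𝒻, F.card = 3)
    (hbig : (n - 1).choose 2 + 2 ≤ 𝒻.card) (hne : ∀ F ∈ 𝒻, W F ≠ ∅)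
    (hdeg : ∀ x ∈ V, n - 1 ≤ (𝒻.filter (x ∈ ·)).card) {F F' : Finset ℕ} {x : ℕ}
    (hF : F ∈ 𝒻) (hF' : F' ∈ 𝒻) (hx : W F = {x}) (hx' : W F' = {x}) : F = F' := by
  by_contra hFF
  have hxF : x ∈ F := (hW F hF).1.subset (by simp [hx])
  have hxF' : x ∈ F' := (hW F' hF').1.subset (by simp [hx'])
  obtain ⟨a, haF, haF', hax⟩ := hW.exists_mem_inter hF' hF hx' hxF
  obtain ⟨b, hbx, hba, hFb⟩ := exists_eq_triple_of_mem (hcard F hF) hxF haF hax.symm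
  obtain ⟨c, hcx, hca, hFc⟩ := exists_eq_triple_of_mem (hcard F' hF') hxF' haF' hax.symm
  have hbc : b ≠ c := by rintro rfl; exact hFF (hFb.trans hFc.symm)
  have hxV := hsub F hF hxF
  have haV := hsub F hF haF
  have hbc_of : ∀ G ∈ 𝒻, x ∈ G → a ∉ G → G = {x, b, c} := by
    intro G hG hxG haG
    obtain ⟨y, hyG, hyF, hyx⟩ := hW.exists_mem_inter hF hG hx hxG
    obtain ⟨z, hzG, hzF, hzx⟩ := hW.exists_mem_inter hF' hG hx' hxG
    have hyb : y = b := by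
      rw [hFb] at hyF; simp only [mem_insert, mem_singleton] at hyF; grind
    have hzc : z = c := by
      rw [hFc] at hzF; simp only [mem_insert, mem_singleton] at hzF; grind
    subst hyb hzc
    exact eq_triple_of_mem (hcard G hG) hxG hyG hzG hyx.symm hzx.symm hbc
  have hstar : ∀ y ∈ V, y ≠ x → y ≠ a → ({x, a, y} : Finset ℕ) ∈ 𝒻 := by
    intro y hy hyx hya
    by_contra hnot
    have hss : 𝒻.filter (x ∈ ·) ⊆
        insert {x, b, c} ((((V.erase x).erase a).erase y).image fun z => {x, a, z}) := by
      intro G hG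
      rw [mem_filter] at hG
      rw [mem_insert, mem_image]
      by_cases haG : a ∈ G
      · obtain ⟨z, hzx, hza, rfl⟩ := exists_eq_triple_of_mem (hcard G hG.1) hG.2 haG hax.symm
        refine Or.inr ⟨z, ?_, rfl⟩
        have : z ∈ V := hsub _ hG.1 (by simp)
        have hzy : z ≠ y := by rintro rfl; exact hnot hG.1
        simp [*]
      · exact Or.inl (hbc_of G hG.1 hG.2 haG)
    have h1 := (card_le_card hss).trans
      ((card_insert_le _ _).trans (Nat.add_le_add_right card_image_le 1))
    rw [card_erase_of_mem (by simp [*]), card_erase_of_mem (by simp [*]),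
      card_erase_of_mem hxV, hV] at h1
    have := hdeg x hxV
    omega
  have key : ∀ E ∈ 𝒻, a ∉ E → (∃ w, W E = {w}) → E = {x, b, c} := by
    rintro E hE haE ⟨w, hw⟩
    have hwE : w ∈ E := (hW E hE).1.subset (by simp [hw])
    by_cases hwx : w = x
    · subst hwx
      obtain ⟨y, hyV, hy⟩ := exists_mem_notMem_of_card_lt_card
        (show (insert a E).card < V.card by
          have := card_insert_le a E
          have := hcard E hE
          omega)
      simp only [mem_insert, not_or] at hy
      have hyw : y ≠ w := by rintro rfl; exact hy.2 hwE
      obtain ⟨z, hz, hzE, hzw⟩ :=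
        hW.exists_mem_inter hE (hstar y hyV hyw hy.1) hw (by simp)
      simp only [mem_insert, mem_singleton] at hz
      grind
    · have hwa : w ≠ a := by rintro rfl; exact haE hwE
      obtain ⟨z, hz, hzE, hzw⟩ :=
        hW.exists_mem_inter hE (hstar w (hsub E hE hwE) hwx hwa) hw (by simp)
      simp only [mem_insert, mem_singleton] at hz
      refine hbc_of E hE ?_ haE
      grind
  obtain ⟨E₁, h₁, E₂, h₂, hne', ha₁, ha₂, hw₁, hw₂⟩ :=
    hW.exists_pair_avoiding hV hsub hcard hbig hne haV
  exact hne' ((key E₁ h₁ ha₁ hw₁).trans (key E₂ h₂ ha₂ hw₂).symm)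

/-- Two members avoiding `v` with distinct singleton witnesses force many pairs of `V \ {v}`
to be absent from the link of `v`. -/
lemma MaximalWitness.degree_add_le_of_pair {n : ℕ} (hn : 8 ≤ n) {𝒻 : Finset (Finset ℕ)}
    {W : Finset ℕ → Finset ℕ} (hW : MaximalWitness 𝒻 W) {V : Finset ℕ} (hV : V.card = n)
    (hsub : ∀ F ∈ 𝒻, F ⊆ V) (hcard : ∀ F ∈ 𝒻, F.card = 3) {v : ℕ} (hv : v ∈ V)
    {E₁ E₂ : Finset ℕ} (h₁ : E₁ ∈ 𝒻) (h₂ : E₂ ∈ 𝒻) (hv₁ : v ∉ E₁) (hv₂ : v ∉ E₂) {w₁ w₂ : ℕ}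
    (hw₁ : W E₁ = {w₁}) (hw₂ : W E₂ = {w₂}) (hw : w₁ ≠ w₂) :
    (𝒻.filter (v ∈ ·)).card + (2 * n - 9) ≤ (n - 1).choose 2 := by
  set A := 𝒻.filter (v ∈ ·)
  have hA : (A.image fun F => F.erase v).card = A.card := card_image_of_injOn (injOn_erase 𝒻 v)
  let M : ℕ → Finset ℕ → Finset (Finset ℕ) := fun w E =>
    ((V.erase v) \ E).image fun y => {w, y}
  have hM : ∀ w, ∀ E ∈ 𝒻, v ∉ E → W E = {w} → (M w E).card = n - 4 ∧
      Disjoint (A.image fun F => F.erase v) (M w E) ∧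
      ∀ p ∈ M w E, p ⊆ V.erase v ∧ p.card = 2 := by
    intro w E hE hvE hwE
    have hwm : w ∈ E := (hW E hE).1.subset (by simp [hwE])
    have hEV : E ⊆ V.erase v := subset_erase.2 ⟨hsub E hE, hvE⟩
    refine ⟨?_, ?_, ?_⟩
    · rw [card_image_of_injOn, card_sdiff_of_subset hEV, card_erase_of_mem hv, hcard E hE, hV]
      · omega
      · intro y hy z hz hyz
        simp only [coe_sdiff, Set.mem_sdiff, mem_coe] at hy hz
        have hyw : y ≠ w := by rintro rfl; exact hy.2 hwm
        have : y ∈ ({w, z} : Finset ℕ) := by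
          have h : ({w, y} : Finset ℕ) = {w, z} := hyz
          rw [← h]; simp
        simpa [hyw] using this
    · rw [disjoint_left]
      intro p hp hp'
      obtain ⟨F, hF, rfl⟩ := mem_image.1 hp
      obtain ⟨y, hy, hyF⟩ := mem_image.1 hp'
      simp only [A, mem_filter] at hF
      have hFE : F = insert v {w, y} := by rw [hyF, insert_erase hF.2]
      obtain ⟨z, hz, hzE, hzw⟩ := hW.exists_mem_inter hE hF.1 hwE (by simp [hFE])
      rw [hFE] at hz
      simp only [mem_insert, mem_singleton, mem_sdiff] at hz hy
      grind
    · intro p hp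
      obtain ⟨y, hy, rfl⟩ := mem_image.1 hp
      rw [mem_sdiff] at hy
      have hyw : w ≠ y := by rintro rfl; exact hy.2 hwm
      exact ⟨insert_subset (hEV hwm) (singleton_subset_iff.2 hy.1), card_pair hyw⟩
  obtain ⟨hc₁, hd₁, hp₁⟩ := hM w₁ E₁ h₁ hv₁ hw₁
  obtain ⟨hc₂, hd₂, hp₂⟩ := hM w₂ E₂ h₂ hv₂ hw₂
  have hinter : (M w₁ E₁ ∩ M w₂ E₂).card ≤ 1 := by
    refine (card_le_card (t := {{w₁, w₂}}) fun p hp => ?_).trans (card_singleton _).le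
    rw [mem_inter] at hp
    obtain ⟨y, -, rfl⟩ := mem_image.1 hp.1
    obtain ⟨z, -, hz⟩ := mem_image.1 hp.2
    have h : w₂ ∈ ({w₁, y} : Finset ℕ) := by rw [← hz]; simp
    have hy : w₂ = y := by simpa [hw.symm] using h
    simp [hy]
  have hunion := card_union_add_card_inter (M w₁ E₁) (M w₂ E₂)
  have htot : ((A.image fun F => F.erase v) ∪ (M w₁ E₁ ∪ M w₂ E₂)).card ≤ (n - 1).choose 2 := by
    refine card_pairs_erase_le hV hv fun p hp => ?_
    rcases mem_union.1 hp with hp | hp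
    · obtain ⟨F, hF, rfl⟩ := mem_image.1 hp
      simp only [A, mem_filter] at hF
      exact ⟨erase_subset_erase _ (hsub F hF.1), by rw [card_erase_of_mem hF.2, hcard F hF.1]⟩
    · exact (mem_union.1 hp).elim (hp₁ p) (hp₂ p)
  rw [card_union_of_disjoint (disjoint_union_right.2 ⟨hd₁, hd₂⟩), hA] at htot
  omega

/-- Members whose two-element witness contains `x`. -/
def pairWitnessed (𝒻 : Finset (Finset ℕ)) (W : Finset ℕ → Finset ℕ) (x : ℕ) :
    Finset (Finset ℕ) :=
  𝒻.filter fun F => (W F).card = 2 ∧ x ∈ W F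

lemma MaximalWitness.card_pairWitnessed_le {n : ℕ} {𝒻 : Finset (Finset ℕ)}
    {W : Finset ℕ → Finset ℕ} (hW : MaximalWitness 𝒻 W) {V : Finset ℕ} (hV : V.card = n)
    (hsub : ∀ F ∈ 𝒻, F ⊆ V) (hcard : ∀ F ∈ 𝒻, F.card = 3) {v : ℕ} (hv : v ∈ V) :
    (pairWitnessed 𝒻 W v).card ≤ n - 1 := by
  have h1 : (pairWitnessed 𝒻 W v).card ≤ ((V.erase v).image fun y => ({v, y} : Finset ℕ)).card := by
    refine card_le_card_of_injOn W ?_ ?_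
    · intro F hF
      simp only [pairWitnessed, coe_filter, Set.mem_ofPred_eq] at hF
      obtain ⟨y, hy⟩ := card_eq_one.1
        (show ((W F).erase v).card = 1 by rw [card_erase_of_mem hF.2.2, hF.2.1])
      have hyW : y ∈ (W F).erase v := by simp [hy]
      rw [mem_coe, mem_image]
      refine ⟨y, mem_erase.2 ⟨ne_of_mem_erase hyW,
        hsub F hF.1 ((hW F hF.1).1.subset (mem_of_mem_erase hyW))⟩, ?_⟩
      rw [← insert_erase hF.2.2, hy]
    · intro F hF G hG h
      simp only [pairWitnessed, coe_filter, Set.mem_ofPred_eq] at hF hG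
      exact hW.eq_of_subset hcard hG.1 hF.1 hG.2.1 (h ▸ (hW F hF.1).1.subset)
  have h2 := h1.trans card_image_le
  rwa [card_erase_of_mem hv, hV] at h2

/-- The degree bound at a point which is a singleton witness. -/
lemma MaximalWitness.degree_add_pairWitnessed_le {n : ℕ} (hn : 8 ≤ n) {𝒻 : Finset (Finset ℕ)}
    {W : Finset ℕ → Finset ℕ} (hW : MaximalWitness 𝒻 W) {V : Finset ℕ} (hV : V.card = n)
    (hsub : ∀ F ∈ 𝒻, F ⊆ V) (hcard : ∀ F ∈ 𝒻, F.card = 3) {E : Finset ℕ} (hE : E ∈ 𝒻) {x : ℕ}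
    (hx : W E = {x}) :
    (𝒻.filter (x ∈ ·)).card + (pairWitnessed 𝒻 W x).card ≤ 2 * n - 5 := by
  obtain ⟨a, b, hxa, hxb, hab, hEab⟩ := hW.exists_eq_triple hcard hE hx
  -- The members through `x` other than `E` are of the form `{x, a, y}` or `{x, b, y}`.
  have hform : ∀ F ∈ 𝒻, x ∈ F → F ≠ E → ∃ y ∈ V \ E, F = {x, a, y} ∨ F = {x, b, y} := by
    intro F hF hxF hFE
    have hnot : ∀ y, F = {x, a, y} ∨ F = {x, b, y} → y ≠ x → y ≠ a → y ≠ b → y ∈ V \ E := by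
      intro y h hyx hya hyb
      rw [mem_sdiff]
      refine ⟨hsub F hF ?_, by simp [*]⟩
      rcases h with h | h <;> simp [h]
    obtain ⟨z, hzF, hzE, hzx⟩ := hW.exists_mem_inter hE hF hx hxF
    obtain ⟨y, hyx, hyz, hFy⟩ := exists_eq_triple_of_mem (hcard F hF) hxF hzF hzx.symm
    rw [hEab] at hzE
    simp only [mem_insert, mem_singleton, hzx, false_or] at hzE
    rcases hzE with rfl | rfl
    · have hyb : y ≠ b := by rintro rfl; exact hFE (hFy.trans hEab.symm)
      exact ⟨y, hnot y (Or.inl hFy) hyx hyz hyb, Or.inl hFy⟩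
    · have hya : y ≠ a := by
        rintro rfl
        exact hFE (by rw [hFy, hEab, pair_comm])
      exact ⟨y, hnot y (Or.inr hFy) hyx hya hyz, Or.inr hFy⟩
  -- The pairs `{x, a}` and `{x, b}` lie in several members, so they are not witnesses.
  have hpair : ∀ F ∈ pairWitnessed 𝒻 W x, ∀ c ∈ E, c ≠ x → c ∉ W F := by
    intro F hF c hcE hcx hc
    simp only [pairWitnessed, mem_filter] at hF
    have hxE : x ∈ E := by simp [hEab]
    have hWF : W F = {x, c} := by
      refine (eq_of_subset_of_card_le ?_ ?_).symm
      · simp [insert_subset_iff, hF.2.2, hc]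
      · rw [hF.2.1, card_pair hcx.symm]
    have hss : ({x, c} : Finset ℕ) ⊂ E := by
      refine Finset.ssubset_iff_subset_ne.2 ⟨by simp [insert_subset_iff, hxE, hcE], fun h => ?_⟩
      have := hcard E hE
      rw [← h, card_pair hcx.symm] at this
      omega
    obtain ⟨G, hG, hGE⟩ := (hW E hE).2.2 {x, c} hss (by rw [hx, card_pair hcx.symm]; simp)
    have hGF := hW.eq_of_subset hcard hF.1 hG hF.2.1 (by rw [hWF, ← hGE]; exact inter_subset_left)
    have hEF := hW.eq_of_subset hcard hF.1 hE hF.2.1 (by rw [hWF]; exact hss.subset)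
    rw [hGF, ← hEF, inter_self] at hGE
    exact hss.ne hGE.symm
  set D := (𝒻.filter (x ∈ ·)).erase E
  set P := (pairWitnessed 𝒻 W x).image fun F => symmDiff F {a, b}
  set U := ((V \ E).image fun y => ({x, a, y} : Finset ℕ)) ∪
    (V \ E).image fun y => ({x, b, y} : Finset ℕ)
  have hD : D.card = (𝒻.filter (x ∈ ·)).card - 1 :=
    card_erase_of_mem (mem_filter.2 ⟨hE, by simp [hEab]⟩)
  have hP : P.card = (pairWitnessed 𝒻 W x).card :=
    card_image_of_injective _ (symmDiff_left_injective _)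
  have hPform : ∀ F ∈ pairWitnessed 𝒻 W x, ∃ y ∈ V \ E, W F = {x, y} ∧
      (symmDiff F {a, b} = {x, a, y} ∧ a ∉ F ∨ symmDiff F {a, b} = {x, b, y} ∧ b ∉ F) := by
    intro F hF
    have hF' := hF
    simp only [pairWitnessed, mem_filter] at hF'
    have ha := hpair F hF a (by simp [hEab]) hxa.symm
    have hb := hpair F hF b (by simp [hEab]) hxb.symm
    have hsW := (hW F hF'.1).1.subset
    have hFE : F ≠ E := by
      rintro rfl
      rw [hx] at hF'
      simp at hF'
    obtain ⟨y, hy, h⟩ := hform F hF'.1 (hsW hF'.2.2) hFE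
    have hyE : y ≠ x ∧ y ≠ a ∧ y ≠ b := by
      rw [mem_sdiff, hEab] at hy
      simpa using hy.2
    refine ⟨y, hy, ?_, ?_⟩
    · refine eq_of_subset_of_card_le (fun z hz => ?_) ?_
      · have hzF := hsW hz
        simp only [mem_insert, mem_singleton]
        rcases h with h | h <;> rw [h] at hzF <;> simp only [mem_insert, mem_singleton] at hzF <;>
          grind
      · rw [hF'.2.1, card_pair hyE.1.symm]
    · rcases h with rfl | rfl
      · right
        refine ⟨?_, by simp; grind⟩
        ext z
        simp only [mem_symmDiff, mem_insert, mem_singleton]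
        grind
      · left
        refine ⟨?_, by simp; grind⟩
        ext z
        simp only [mem_symmDiff, mem_insert, mem_singleton]
        grind
  have hdisj : Disjoint D P := by
    rw [disjoint_left]
    intro G hG hGP
    obtain ⟨F, hF, rfl⟩ := mem_image.1 hGP
    obtain ⟨y, hy, hWF, h⟩ := hPform F hF
    simp only [pairWitnessed, mem_filter] at hF
    have hG𝒻 := (mem_filter.1 (mem_of_mem_erase hG)).1
    have heq := hW.eq_of_subset hcard hF.1 hG𝒻 hF.2.1 (by
      rw [hWF]
      rcases h with h | h <;> rw [h.1] <;> simp [insert_subset_iff])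
    rcases h with h | h <;> exact h.2 (by rw [← heq, h.1]; simp)
  have hsubU : D ∪ P ⊆ U := by
    intro G hG
    simp only [U, mem_union, mem_image]
    rcases mem_union.1 hG with hG | hG
    · rw [mem_erase, mem_filter] at hG
      obtain ⟨y, hy, h | h⟩ := hform G hG.2.1 hG.2.2 hG.1
      · exact Or.inl ⟨y, hy, h.symm⟩
      · exact Or.inr ⟨y, hy, h.symm⟩
    · obtain ⟨F, hF, rfl⟩ := mem_image.1 hG
      obtain ⟨y, hy, -, h | h⟩ := hPform F hF
      · exact Or.inl ⟨y, hy, h.1.symm⟩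
      · exact Or.inr ⟨y, hy, h.1.symm⟩
  have hU : U.card ≤ (n - 3) + (n - 3) := by
    have hVE : (V \ E).card = n - 3 := by rw [card_sdiff_of_subset (hsub E hE), hV, hcard E hE]
    exact (card_union_le _ _).trans
      (Nat.add_le_add (card_image_le.trans hVE.le) (card_image_le.trans hVE.le))
  have := card_le_card hsubU
  rw [card_union_of_disjoint hdisj] at this
  omega

lemma sum_card_filter_mem {V : Finset ℕ} (𝒢 : Finset (Finset ℕ)) (f : Finset ℕ → Finset ℕ)
    {k : ℕ} (hsub : ∀ F ∈ 𝒢, f F ⊆ V) (hk : ∀ F ∈ 𝒢, (f F).card = k) :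
    ∑ x ∈ V, (𝒢.filter (x ∈ f ·)).card = 𝒢.card * k := by
  have h := sum_card_bipartiteAbove_eq_sum_card_bipartiteBelow (s := V) (t := 𝒢)
    (fun x F => x ∈ f F)
  simp only [bipartiteAbove, bipartiteBelow] at h
  rw [h, sum_const_nat fun F hF => ?_]
  rw [filter_mem_eq_inter, inter_eq_right.2 (hsub F hF), hk F hF]

/-- If no member of `𝒻` has empty witness, then at most `n - 2` elements of `[n]`
serve as singleton witnesses. -/
theorem stmt_12 (n : ℕ) (hn : 8 ≤ n) (𝒻 : Finset (Finset ℕ))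
    (hsub : ∀ F ∈ 𝒻, F ⊆ Finset.Icc 1 n) (hcard : ∀ F ∈ 𝒻, F.card = 3)
    (hVC : ∀ S ⊆ Finset.Icc 1 n, S.card = 3 → ¬ Shatters 𝒻 S)
    (hbig : (n - 1).choose 2 + 2 ≤ 𝒻.card)
    (ih : ∀ (V : Finset ℕ) (𝒢 : Finset (Finset ℕ)), V.card = n - 1 →
      (∀ G ∈ 𝒢, G ⊆ V) → (∀ G ∈ 𝒢, G.card = 3) →
      (∀ S ⊆ V, S.card = 3 → ¬ Shatters 𝒢 S) →
      𝒢.card ≤ (n - 2).choose 2 + 1)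
    (W : Finset ℕ → Finset ℕ) (hW : MaximalWitness 𝒻 W)
    (hne : ∀ F ∈ 𝒻, W F ≠ ∅) :
    ((Finset.Icc 1 n).filter (fun x => ∃ F ∈ 𝒻, W F = {x})).card ≤ n - 2 := by
  have hV : (Icc 1 n).card = n := by simp
  by_contra! hL
  have hdeg : ∀ x ∈ Icc 1 n, n - 1 ≤ (𝒻.filter (x ∈ ·)).card := fun x hx =>
    le_degree hn hV hsub hcard hVC hbig ih hx
  have hinj : ∀ F ∈ 𝒻, ∀ F' ∈ 𝒻, ∀ x, W F = {x} → W F' = {x} → F = F' :=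
    fun F hF F' hF' x hx hx' =>
      hW.singleton_injective hn hV hsub hcard hbig hne hdeg hF hF' hx hx'
  obtain ⟨v, hv, hvL⟩ : ∃ v ∈ Icc 1 n, ∀ x ∈ (Icc 1 n).erase v, ∃ F ∈ 𝒻, W F = {x} := by
    have hsplit := card_filter_add_card_filter_not (s := Icc 1 n) (fun x => ∃ F ∈ 𝒻, W F = {x})
    rw [hV] at hsplit
    rcases ((Icc 1 n).filter fun x => ¬ ∃ F ∈ 𝒻, W F = {x}).eq_empty_or_nonempty with h | ⟨v, hv⟩
    · refine ⟨1, by simp; omega, fun x hx => ?_⟩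
      by_contra hx'
      exact notMem_empty x (h ▸ mem_filter.2 ⟨mem_of_mem_erase hx, hx'⟩)
    · refine ⟨v, (mem_filter.1 hv).1, fun x hx => ?_⟩
      by_contra hx'
      exact ne_of_mem_erase hx (card_le_one.1 (by omega) x
        (mem_filter.2 ⟨mem_of_mem_erase hx, hx'⟩) v hv)
  obtain ⟨E₁, h₁, E₂, h₂, hE, hv₁, hv₂, ⟨w₁, hw₁⟩, w₂, hw₂⟩ :=
    hW.exists_pair_avoiding hV hsub hcard hbig hne hv
  have hw : w₁ ≠ w₂ := by
    rintro rfl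
    exact hE (hinj E₁ h₁ E₂ h₂ w₁ hw₁ hw₂)
  have hdv := hW.degree_add_le_of_pair hn hV hsub hcard hv h₁ h₂ hv₁ hv₂ hw₁ hw₂ hw
  have hs : (𝒻.filter fun F => (W F).card = 1).card ≤ n := by
    have : (𝒻.filter fun F => (W F).card = 1).card ≤ (powersetCard 1 (Icc 1 n)).card := by
      refine card_le_card_of_injOn W ?_ ?_
      · intro F hF
        simp only [coe_filter, Set.mem_ofPred_eq] at hF
        exact mem_powersetCard.2 ⟨(hW F hF.1).1.subset.trans (hsub F hF.1), hF.2⟩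
      · intro F hF G hG h
        simp only [coe_filter, Set.mem_ofPred_eq] at hF hG
        obtain ⟨x, hx⟩ := card_eq_one.1 hF.2
        exact hinj F hF.1 G hG.1 x hx (h ▸ hx)
    rwa [card_powersetCard, hV, Nat.choose_one_right] at this
  have hst : 𝒻.card ≤ (𝒻.filter fun F => (W F).card = 1).card +
      (𝒻.filter fun F => (W F).card = 2).card := by
    refine (card_le_card fun F hF => ?_).trans (card_union_le _ _)
    simp only [mem_union, mem_filter]
    have := hW.card_eq_one_or_two hcard hne hF
    tauto
  have hsum₁ : ∑ x ∈ Icc 1 n, (𝒻.filter (x ∈ ·)).card = 𝒻.card * 3 :=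
    sum_card_filter_mem 𝒻 id hsub hcard
  have hsum₂ : ∑ x ∈ Icc 1 n, (pairWitnessed 𝒻 W x).card =
      (𝒻.filter fun F => (W F).card = 2).card * 2 := by
    rw [← sum_card_filter_mem (V := Icc 1 n) _ W
      (fun F hF => (hW F (mem_filter.1 hF).1).1.subset.trans (hsub F (mem_filter.1 hF).1))
      (fun F hF => (mem_filter.1 hF).2)]
    simp only [pairWitnessed, filter_filter]
  have hle : ∑ x ∈ (Icc 1 n).erase v,
      ((𝒻.filter (x ∈ ·)).card + (pairWitnessed 𝒻 W x).card) ≤ (n - 1) * (2 * n - 5) := by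
    refine (sum_le_card_nsmul _ _ (2 * n - 5) fun x hx => ?_).trans ?_
    · obtain ⟨F, hF, hx⟩ := hvL x hx
      exact hW.degree_add_pairWitnessed_le hn hV hsub hcard hF hx
    · rw [card_erase_of_mem hv, hV, smul_eq_mul]
  have hgv := hW.card_pairWitnessed_le hV hsub hcard hv
  rw [← add_sum_erase _ _ hv] at hsum₁ hsum₂
  rw [sum_add_distrib] at hle
  have hchoose : (n - 1).choose 2 * 2 = (n - 1) * (n - 2) := by
    rw [Nat.choose_two_right, Nat.sub_sub,
      Nat.div_mul_cancel (by simpa [Nat.sub_sub] using (Nat.even_mul_pred_self (n - 1)).two_dvd)]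
  obtain ⟨m, rfl⟩ : ∃ m, n = m + 8 := ⟨n - 8, by omega⟩
  simp only [show m + 8 - 1 = m + 7 by omega, show m + 8 - 2 = m + 6 by omega,
    show 2 * (m + 8) - 5 = 2 * m + 11 by omega, show 2 * (m + 8) - 9 = 2 * m + 7 by omega] at *
  nlinarith
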